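/- For every integer i ≥ 2 there is a constant C_i > 0 such that the following holds for every integer q ≥ 2. If G is a graph with at most 2(q²+q+1) vertices in which every vertex has degree at most q+1, then the number of minimal dense i-sets of 2-paths of G is at most C_i·(q²+q+1)^{1+i/2}. -/

import Mathlib

open scoped Classical

/-- A 2-path in a graph `H`: a pair of distinct edges sharing exactly one vertex,
represented by its (2-element) edge set. -/
def IsTwoPath {V : Type} (H : SimpleGraph V) (P : Finset (Sym2 V)) : Prop :=
  ∃ x y z : V, x ≠ y ∧ y ≠ z ∧ x ≠ z ∧ H.Adj x y ∧ H.Adj y z ∧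
    P = {s(x, y), s(y, z)}

/-- The (at most two-element) vertex set of an unordered pair. -/
noncomputable def symVerts {V : Type} (e : Sym2 V) : Finset V :=
  Sym2.lift ⟨fun x y => ({x, y} : Finset V), fun x y => Finset.pair_comm x y⟩ e

/-- The vertex set of a 2-path (given by its edge set). -/
noncomputable def pathVerts {V : Type} (P : Finset (Sym2 V)) : Finset V :=
  P.sup symVerts

/-- A dense `i`-set: `i` distinct 2-paths of `H` whose vertex sets together have at most
`i+1` elements. -/
def IsDense {V : Type} (H : SimpleGraph V) (i : ℕ) (S : Finset (Finset (Sym2 V))) : Prop :=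
  (∀ P ∈ S, IsTwoPath H P) ∧ S.card = i ∧ (S.sup pathVerts).card ≤ i + 1

/-- A minimal dense `i`-set: a dense `i`-set all of whose `j`-element subsets, for
`1 ≤ j ≤ i-1`, are sparse (i.e. not dense). -/
def IsMinimalDense {V : Type} (H : SimpleGraph V) (i : ℕ)
    (S : Finset (Finset (Sym2 V))) : Prop :=
  IsDense H i S ∧
    ∀ j : ℕ, 1 ≤ j → j ≤ i - 1 → ∀ T ⊆ S, T.card = j → ¬ IsDense H j T

theorem mem_pathVerts_aux {V : Type} (x y z v : V) :
    v ∈ pathVerts ({s(x, y), s(y, z)} : Finset (Sym2 V)) ↔ v = x ∨ v = y ∨ v = z := by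
  simp only [pathVerts, Finset.mem_sup, Finset.mem_insert, Finset.mem_singleton,
    exists_eq_or_imp, exists_eq_left, symVerts, Sym2.lift_mk]
  tauto

theorem mem_symVerts_aux {V : Type} (e : Sym2 V) (v : V) : v ∈ symVerts e ↔ v ∈ e := by
  induction e using Sym2.ind with
  | _ x y => simp [symVerts]

/-- A proper nonempty part of the vertex set of a minimal dense set has an outgoing edge. -/
theorem exists_crossing {V : Type} (G : SimpleGraph V) (i : ℕ)
    (S : Finset (Finset (Sym2 V))) (hS : IsMinimalDense G i S) (A : Finset V)
    (hA : A.Nonempty) (hAW : A ⊆ S.sup pathVerts) (hne : A ≠ S.sup pathVerts) :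
    ∃ a ∈ A, ∃ w ∈ S.sup pathVerts, w ∉ A ∧ G.Adj a w := by
  obtain ⟨⟨hpath, hcard, hle⟩, hmin⟩ := hS
  by_contra hcon
  push Not at hcon
  have key : ∀ P ∈ S, ∀ v ∈ pathVerts P, v ∈ A → pathVerts P ⊆ A := by
    intro P hP v hv hvA
    have hsub : ∀ u ∈ pathVerts P, u ∈ S.sup pathVerts := fun u hu =>
      Finset.mem_sup.2 ⟨P, hP, hu⟩
    obtain ⟨x, y, z, -, -, -, hxy, hyz, rfl⟩ := hpath P hP
    have step : ∀ a w, w ∈ pathVerts ({s(x, y), s(y, z)} : Finset (Sym2 V)) →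
        G.Adj a w → a ∈ A → w ∈ A := by
      intro a w hw haw ha
      by_contra hwA
      exact hcon a ha w (hsub w hw) hwA haw
    have hx := (mem_pathVerts_aux x y z x).2 (by simp)
    have hy := (mem_pathVerts_aux x y z y).2 (by simp)
    have hz := (mem_pathVerts_aux x y z z).2 (by simp)
    have h1 := step x y hy hxy
    have h2 := step y x hx hxy.symm
    have h3 := step y z hz hyz
    have h4 := step z y hy hyz.symm
    intro u hu
    rw [mem_pathVerts_aux] at hu hv
    rcases hv with rfl | rfl | rfl <;> rcases hu with rfl | rfl | rfl <;> tauto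
  set T := S.filter (fun P => pathVerts P ⊆ A) with hT
  set U := S.filter (fun P => ¬ pathVerts P ⊆ A) with hU
  have hTU : T.card + U.card = i := by
    rw [← hcard]; exact Finset.card_filter_add_card_filter_not _
  have hTne : T.Nonempty := by
    obtain ⟨a, ha⟩ := hA
    obtain ⟨P, hP, haP⟩ := Finset.mem_sup.1 (hAW ha)
    exact ⟨P, Finset.mem_filter.2 ⟨hP, key P hP a haP ha⟩⟩
  have hUne : U.Nonempty := by
    obtain ⟨w, hw, hwA⟩ := Finset.exists_of_ssubset (hAW.ssubset_of_ne hne)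
    obtain ⟨P, hP, hwP⟩ := Finset.mem_sup.1 hw
    exact ⟨P, Finset.mem_filter.2 ⟨hP, fun h => hwA (h hwP)⟩⟩
  have hTpos := hTne.card_pos
  have hUpos := hUne.card_pos
  have hTs : T ⊆ S := Finset.filter_subset _ _
  have hUs : U ⊆ S := Finset.filter_subset _ _
  have hT2 : T.card + 1 < (T.sup pathVerts).card := by
    by_contra h
    exact hmin T.card hTpos (by omega) T hTs rfl
      ⟨fun P hP => hpath P (hTs hP), rfl, by omega⟩
  have hU2 : U.card + 1 < (U.sup pathVerts).card := by
    by_contra h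
    exact hmin U.card hUpos (by omega) U hUs rfl
      ⟨fun P hP => hpath P (hUs hP), rfl, by omega⟩
  have hdisj : Disjoint (T.sup pathVerts) (U.sup pathVerts) := by
    rw [Finset.disjoint_left]
    intro v hv hv'
    obtain ⟨P, hP, hvP⟩ := Finset.mem_sup.1 hv
    obtain ⟨Q, hQ, hvQ⟩ := Finset.mem_sup.1 hv'
    have hvA : v ∈ A := (Finset.mem_filter.1 hP).2 hvP
    exact (Finset.mem_filter.1 hQ).2 (key Q (hUs hQ) v hvQ hvA)
  have hun : T.sup pathVerts ∪ U.sup pathVerts ⊆ S.sup pathVerts :=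
    Finset.union_subset (Finset.sup_mono hTs) (Finset.sup_mono hUs)
  have := Finset.card_le_card hun
  rw [Finset.card_union_of_disjoint hdisj] at this
  omega

/-- Vertex sets obtained from a single vertex by adding at most `k` neighbours in turn. -/
noncomputable def growFam {V : Type} [Fintype V] (G : SimpleGraph V) [DecidableRel G.Adj] :
    ℕ → Finset (Finset V)
  | 0 => Finset.univ.image (fun v => {v})
  | k + 1 => (growFam G k).biUnion
      (fun A => insert A (A.biUnion (fun a => (G.neighborFinset a).image (fun w => insert w A))))

theorem growFam_card_mem {V : Type} [Fintype V] (G : SimpleGraph V) [DecidableRel G.Adj]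
    (k : ℕ) : ∀ A ∈ growFam G k, A.card ≤ k + 1 := by
  induction k with
  | zero => intro A hA; simp only [growFam, Finset.mem_image] at hA; obtain ⟨v, -, rfl⟩ := hA; simp
  | succ k ih =>
    intro B hB
    simp only [growFam, Finset.mem_biUnion, Finset.mem_insert, Finset.mem_image] at hB
    obtain ⟨A, hA, rfl | ⟨a, -, w, -, rfl⟩⟩ := hB
    · exact (ih _ hA).trans (by omega)
    · exact (Finset.card_insert_le _ _).trans (by have := ih _ hA; omega)

theorem growFam_card {V : Type} [Fintype V] (G : SimpleGraph V) [DecidableRel G.Adj]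
    (q i : ℕ) (hd : ∀ v : V, G.degree v ≤ q + 1) (k : ℕ) (hk : k ≤ i) :
    (growFam G k).card ≤ Fintype.card V * ((i + 2) * (q + 1)) ^ k := by
  induction k with
  | zero => simpa [growFam] using (Finset.card_image_le (s := (Finset.univ : Finset V)))
  | succ k ih =>
    have h1 : (growFam G (k + 1)).card ≤ (growFam G k).card * ((i + 2) * (q + 1)) := by
      rw [growFam]
      apply Finset.card_biUnion_le_card_mul
      intro A hA
      have hAc := growFam_card_mem G k A hA
      refine (Finset.card_insert_le _ _).trans ?_
      have h2 := Finset.card_biUnion_le_card_mul A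
        (fun a => (G.neighborFinset a).image (fun w => insert w A)) (q + 1)
        (fun a _ => Finset.card_image_le.trans (by simpa using hd a))
      have h3 : A.card * (q + 1) ≤ (i + 1) * (q + 1) := Nat.mul_le_mul_right _ (by omega)
      nlinarith
    refine h1.trans ?_
    rw [pow_succ, ← mul_assoc (Fintype.card V)]
    exact Nat.mul_le_mul_right _ (ih (by omega))

theorem minimal_mem_growFam {V : Type} [Fintype V] (G : SimpleGraph V) [DecidableRel G.Adj]
    (i : ℕ) (hi : 2 ≤ i) (S : Finset (Finset (Sym2 V))) (hS : IsMinimalDense G i S) :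
    S.sup pathVerts ∈ growFam G i := by
  have key : ∀ k : ℕ, S.sup pathVerts ∈ growFam G k ∨
      ∃ A ∈ growFam G k, A ⊆ S.sup pathVerts ∧ A.card = k + 1 := by
    intro k
    induction k with
    | zero =>
      right
      have hne : S.Nonempty := by
        rw [← Finset.card_pos, hS.1.2.1]; omega
      obtain ⟨P, hP⟩ := hne
      obtain ⟨x, y, z, -, -, -, -, -, rfl⟩ := hS.1.1 P hP
      refine ⟨{x}, by simp [growFam], ?_, by simp⟩
      rw [Finset.singleton_subset_iff]
      exact Finset.mem_sup.2 ⟨_, hP, (mem_pathVerts_aux x y z x).2 (by simp)⟩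
    | succ k ih =>
      have hmono : ∀ A ∈ growFam G k, A ∈ growFam G (k + 1) := by
        intro A hA
        rw [growFam, Finset.mem_biUnion]
        exact ⟨A, hA, Finset.mem_insert_self _ _⟩
      rcases ih with h | ⟨A, hA, hAW, hAc⟩
      · exact Or.inl (hmono _ h)
      · by_cases hAe : A = S.sup pathVerts
        · left; rw [← hAe]; exact hmono _ hA
        · right
          obtain ⟨a, ha, w, hw, hwA, hadj⟩ := exists_crossing G i S hS A
            (Finset.card_pos.1 (by omega)) hAW hAe
          refine ⟨insert w A, ?_, Finset.insert_subset hw hAW, ?_⟩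
          · rw [growFam, Finset.mem_biUnion]
            refine ⟨A, hA, Finset.mem_insert_of_mem ?_⟩
            rw [Finset.mem_biUnion]
            exact ⟨a, ha, Finset.mem_image.2 ⟨w, by simpa using hadj, rfl⟩⟩
          · rw [Finset.card_insert_of_notMem hwA, hAc]
  rcases key i with h | ⟨A, hA, hAW, hAc⟩
  · exact h
  · rw [← Finset.eq_of_subset_of_card_le hAW (by rw [hAc]; exact hS.1.2.2)]
    exact hA

theorem count_nat {V : Type} [Fintype V] (G : SimpleGraph V) [DecidableRel G.Adj]
    (q i : ℕ) (hi : 2 ≤ i) (hd : ∀ v : V, G.degree v ≤ q + 1) :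
    Set.ncard {S : Finset (Finset (Sym2 V)) | IsMinimalDense G i S} ≤
      Fintype.card V * ((i + 2) * (q + 1)) ^ i * 2 ^ 2 ^ (i + 2).choose 2 := by
  have hsub : {S : Finset (Finset (Sym2 V)) | IsMinimalDense G i S} ⊆
      ((growFam G i).biUnion (fun W => W.sym2.powerset.powerset) :
        Finset (Finset (Finset (Sym2 V)))) := by
    intro S hS
    rw [Finset.mem_coe, Finset.mem_biUnion]
    refine ⟨S.sup pathVerts, minimal_mem_growFam G i hi S hS, ?_⟩
    rw [Finset.mem_powerset]
    intro P hP
    rw [Finset.mem_powerset]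
    intro e he
    rw [Finset.mem_sym2_iff]
    intro v hv
    exact Finset.mem_sup.2 ⟨P, hP, Finset.mem_sup.2 ⟨e, he, (mem_symVerts_aux e v).2 hv⟩⟩
  have h1 := Set.ncard_le_ncard hsub (Finset.finite_toSet _)
  rw [Set.ncard_coe_finset] at h1
  refine h1.trans ((Finset.card_biUnion_le_card_mul _ _ (2 ^ 2 ^ (i + 2).choose 2) ?_).trans
    (Nat.mul_le_mul_right _ (growFam_card G q i hd i le_rfl)))
  intro W hW
  have hc := growFam_card_mem G i W hW
  rw [Finset.card_powerset, Finset.card_powerset, Finset.card_sym2]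
  exact Nat.pow_le_pow_right (by norm_num) (Nat.pow_le_pow_right (by norm_num)
    (Nat.choose_le_choose 2 (by omega)))

/-- For every `i ≥ 2` there is a constant `C_i > 0` such that, for every `q ≥ 2` and every
graph `G` with at most `2(q²+q+1)` vertices and maximum degree at most `q+1`, the number
of minimal dense `i`-sets of 2-paths of `G` is at most `C_i·(q²+q+1)^{1+i/2}`. -/
theorem count_minimal_dense_sets (i : ℕ) (hi : 2 ≤ i) :
    ∃ C : ℝ, 0 < C ∧ ∀ q : ℕ, 2 ≤ q →
      ∀ (V : Type) [Fintype V] (G : SimpleGraph V) [DecidableRel G.Adj],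
        Fintype.card V ≤ 2 * (q ^ 2 + q + 1) →
        (∀ v : V, G.degree v ≤ q + 1) →
        (Set.ncard {S : Finset (Finset (Sym2 V)) | IsMinimalDense G i S} : ℝ) ≤
          C * ((q ^ 2 + q + 1 : ℕ) : ℝ) ^ ((1 : ℝ) + (i : ℝ) / 2) := by
  obtain ⟨M, hM⟩ : ∃ M : ℕ, M = 2 ^ 2 ^ (i + 2).choose 2 := ⟨_, rfl⟩
  have hMpos : 0 < M := by rw [hM]; positivity
  refine ⟨2 * (2 * ((i : ℝ) + 2)) ^ i * M, by positivity, ?_⟩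
  intro q hq V _ G _ hV hd
  have h := count_nat G q i hi hd
  rw [← hM] at h
  obtain ⟨N, hN⟩ : ∃ N : ℕ, N = q ^ 2 + q + 1 := ⟨_, rfl⟩
  rw [← hN] at hV ⊢
  have hNpos : (0 : ℝ) < N := by rw [hN]; positivity
  have hsq : ((q : ℝ) + 1) ≤ 2 * Real.sqrt N := by
    have h0 : ((q : ℝ) + 1) ≤ Real.sqrt (4 * N) := by
      apply Real.le_sqrt_of_sq_le
      rw [hN]; push_cast; nlinarith [sq_nonneg (q : ℝ), (Nat.cast_nonneg q : (0 : ℝ) ≤ q)]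
    rwa [Real.sqrt_mul (by norm_num), show (4 : ℝ) = 2 ^ 2 by norm_num,
      Real.sqrt_sq (by norm_num)] at h0
  have hpow : (N : ℝ) ^ ((1 : ℝ) + (i : ℝ) / 2) = N * Real.sqrt N ^ i := by
    rw [Real.rpow_add hNpos, Real.rpow_one, Real.sqrt_eq_rpow, ← Real.rpow_natCast,
      ← Real.rpow_mul hNpos.le]
    congr 2; ring
  rw [hpow]
  have hR : (Set.ncard {S : Finset (Finset (Sym2 V)) | IsMinimalDense G i S} : ℝ) ≤
      (Fintype.card V : ℝ) * (((i : ℝ) + 2) * ((q : ℝ) + 1)) ^ i * M := by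
    exact_mod_cast h
  have hV' : (Fintype.card V : ℝ) ≤ 2 * N := by exact_mod_cast hV
  calc _ ≤ _ := hR
    _ ≤ (2 * N) * (((i : ℝ) + 2) * (2 * Real.sqrt N)) ^ i * M := by gcongr
    _ = _ := by simp only [mul_pow]; ring
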